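/- Suppose g ∈ H^t with t ≥ 1, the continuous function on 𝕌 with Fourier coefficients g is nonvanishing (min_{z∈𝕌}|g(z)| > 0), and the equation 𝒞⁺u − (𝒞⁻u)·g = g − 1 has a unique solution u ∈ L², which moreover lies in H^t. Let s be a real number with either s = 0 or s > 1/2, and assume 2s < t. Then there exist N₀ > 0 and C_{s,t} > 0 such that for every N > N₀ the operator 𝒞⁺ − 𝓜_N(g)𝒞⁻ : ran 𝒫_N → ran 𝒫_N is invertible, where 𝓜_N(g) = 𝒫_N𝓜(g)𝒫_N, and the unique u_N ∈ ran 𝒫_N satisfying (𝒞⁺ − 𝓜_N(g)𝒞⁻)u_N = 𝒫_N(g − 1) obeys ‖u − u_N‖_s ≤ C_{s,t}·N^{s−t}. -/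

import Mathlib

noncomputable section

open scoped BigOperators

/-- The Sobolev weight `max(1,|j|)`. -/
def wt (j : ℤ) : ℝ := max 1 |(j : ℝ)|

/-- Membership of a two-sided sequence in the Sobolev space `H^s`. -/
def hsumm (s : ℝ) (u : ℤ → ℂ) : Prop :=
  Summable fun j : ℤ => ‖u j‖ ^ 2 * wt j ^ (2 * s)

/-- The `H^s` norm of a two-sided sequence. -/
def hnorm (s : ℝ) (u : ℤ → ℂ) : ℝ :=
  Real.sqrt (∑' j : ℤ, ‖u j‖ ^ 2 * wt j ^ (2 * s))

/-- `N₋ = ⌊N/2⌋`. -/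
def Nmin (N : ℕ) : ℤ := (N : ℤ) / 2

/-- `N₊ = ⌊(N-1)/2⌋`. -/
def Npl (N : ℕ) : ℤ := ((N : ℤ) - 1) / 2

/-- The Fourier truncation projection `𝒫_N`. -/
def projP (N : ℕ) (u : ℤ → ℂ) : ℤ → ℂ :=
  fun j => if -Nmin N ≤ j ∧ j ≤ Npl N then u j else 0

/-- The trigonometric interpolation projection `𝓘_N` (via the aliasing formula). -/
def interpI (N : ℕ) (u : ℤ → ℂ) : ℤ → ℂ :=
  fun j => if -Nmin N ≤ j ∧ j ≤ Npl N then ∑' p : ℤ, u (p * (N : ℤ) + j) else 0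

/-- Membership in `ran 𝒫_N`. -/
def inPN (N : ℕ) (u : ℤ → ℂ) : Prop := projP N u = u

/-- The boundary value `𝒞⁺` of the Cauchy transform: keep the nonnegative modes. -/
def Cpl (u : ℤ → ℂ) : ℤ → ℂ := fun j => if 0 ≤ j then u j else 0

/-- The boundary value `𝒞⁻` of the Cauchy transform: `-1` times the negative modes. -/
def Cmn (u : ℤ → ℂ) : ℤ → ℂ := fun j => if j < 0 then -u j else 0

/-- Multiplication of functions on `𝕌`, i.e. convolution of Fourier coefficients:
`𝓜(g)u = g·u`. -/
def cmul (g u : ℤ → ℂ) : ℤ → ℂ := fun n => ∑' j : ℤ, g (n - j) * u j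

/-- The Fourier coefficients of the constant function `1`. -/
def one1 : ℤ → ℂ := fun j => if j = 0 then 1 else 0
/-- The continuous function on `𝕌` with Fourier coefficients `g` is nonvanishing:
`min_{z ∈ 𝕌} |g(z)| > 0`. -/
def nonvanishing (g : ℤ → ℂ) : Prop :=
  ∃ ε : ℝ, 0 < ε ∧ ∀ θ : ℝ,
    ε ≤ ‖∑' j : ℤ, g j * Complex.exp (Complex.I * (j : ℂ) * (θ : ℂ))‖

/-- The Toeplitz operator `𝒯(g) = 𝒞⁺ 𝓜(g) 𝒞⁺`. -/
def Topl (g u : ℤ → ℂ) : ℤ → ℂ := Cpl (cmul g (Cpl u))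

/-- If the power series `∑ c_k z^k` is absolutely convergent and has no zero in the closed unit
disk, then evaluating it at a contraction `X` gives an element that is invertible inside the closed
algebra generated by `X`. -/
theorem exists_inverse_mem_elemental {A : Type*} [NormedRing A] [NormOneClass A] [NormedAlgebra ℂ A]
    [CompleteSpace A] (X : A) (hX : ‖X‖ ≤ 1) (c : ℕ → ℂ) (hc : Summable fun k => ‖c k‖)
    (hne : ∀ z : ℂ, ‖z‖ ≤ 1 → ∑' k, c k * z ^ k ≠ 0) :
    (∑' k, c k • X ^ k) ∈ Algebra.elemental ℂ X ∧ ∃ Y ∈ Algebra.elemental ℂ X,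
      (∑' k, c k • X ^ k) * Y = 1 ∧ Y * (∑' k, c k • X ^ k) = 1 := by
  let : NormedCommRing (Algebra.elemental ℂ X) :=
    { SubringClass.toNormedRing (Algebra.elemental ℂ X) with mul_comm := mul_comm }
  let : NormedAlgebra ℂ (Algebra.elemental ℂ X) :=
    { norm_smul_le := fun a b => norm_smul_le a (b : A) }
  have hsummable : ∀ {B : Type _} [NormedRing B] [NormOneClass B] [NormedAlgebra ℂ B]
      [CompleteSpace B] (x : B), ‖x‖ ≤ 1 → Summable fun k => c k • x ^ k := by
    intro B _ _ _ _ x hx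
    refine Summable.of_norm_bounded hc fun k => ?_
    rw [norm_smul]
    exact mul_le_of_le_one_right (norm_nonneg _)
      ((norm_pow_le x k).trans (pow_le_one₀ (norm_nonneg _) hx))
  let x : Algebra.elemental ℂ X := ⟨X, Algebra.elemental.self_mem ℂ X⟩
  have : NormOneClass (Algebra.elemental ℂ X) := ⟨by
    change ‖(1 : A)‖ = 1
    exact norm_one⟩
  have hx : ‖x‖ ≤ 1 := hX
  have hs := hsummable x hx
  have hunit : IsUnit (∑' k, c k • x ^ k) := by
    by_contra hcon
    obtain ⟨χ, hχ⟩ := WeakDual.CharacterSpace.exists_apply_eq_zero hcon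
    refine hne (χ x) ((AlgHom.norm_apply_le_self χ x).trans hx) ?_
    rw [← hχ, (hs.hasSum.map χ (map_continuous χ)).tsum_eq.symm]
    exact tsum_congr fun k => by simp
  have hval : ((∑' k, c k • x ^ k : Algebra.elemental ℂ X) : A) = ∑' k, c k • X ^ k :=
    (hs.hasSum.map (Algebra.elemental ℂ X).val continuous_subtype_val).tsum_eq.symm
  obtain ⟨v, hv⟩ := hunit
  refine ⟨hval ▸ Subtype.coe_prop _, ((v⁻¹ : _ˣ) : Algebra.elemental ℂ X), Subtype.coe_prop _,
    ?_, ?_⟩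
  · rw [← hval, ← hv, ← MulMemClass.coe_mul, Units.mul_inv, OneMemClass.coe_one]
  · rw [← hval, ← hv, ← MulMemClass.coe_mul, Units.inv_mul, OneMemClass.coe_one]

/-- Square-summable two-sided sequences. -/
abbrev SqSumm : Type := lp (fun _ : ℤ => ℂ) 2

/-- Bounded operators on square-summable two-sided sequences. -/
abbrev SqOp : Type := SqSumm →L[ℂ] SqSumm

theorem memℓp_two_iff {u : ℤ → ℂ} : Memℓp u 2 ↔ Summable fun j => ‖u j‖ ^ 2 := by
  rw [memℓp_gen_iff (by norm_num)]
  simp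

theorem hsumm_zero_iff {u : ℤ → ℂ} : hsumm 0 u ↔ Memℓp u 2 := by
  rw [memℓp_two_iff, hsumm]
  simp

theorem SqSumm.norm_sq (x : SqSumm) : ‖x‖ ^ 2 = ∑' j, ‖x j‖ ^ 2 := by
  have := lp.norm_rpow_eq_tsum (p := 2) (by norm_num) x
  simpa using this

/-- Restriction of a sequence to a set of modes. -/
def restr (s : Set ℤ) : SqOp :=
  LinearMap.mkContinuous
    { toFun := fun x => ⟨s.indicator x, (lp.memℓp x).mono' fun i => norm_indicator_le_norm_self _ _⟩
      map_add' := fun x y => by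
        apply lp.ext
        exact Set.indicator_add s _ _
      map_smul' := fun a x => by
        apply lp.ext
        exact Set.indicator_const_smul s a _ } 1
    (fun x => by
      rw [one_mul]
      exact lp.norm_mono two_ne_zero fun i => norm_indicator_le_norm_self _ _)

open Classical in
theorem restr_apply (s : Set ℤ) (x : SqSumm) (j : ℤ) :
    restr s x j = if j ∈ s then x j else 0 := rfl

theorem norm_restr_le (s : Set ℤ) : ‖restr s‖ ≤ 1 :=
  LinearMap.mkContinuous_norm_le _ zero_le_one _

theorem norm_restr_apply_le (s : Set ℤ) (x : SqSumm) : ‖restr s x‖ ≤ ‖x‖ := by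
  simpa using (restr s).le_of_opNorm_le (norm_restr_le s) x

/-- Translation of sequences, i.e. multiplication by `z ^ k`. -/
def shift (k : ℤ) : SqOp :=
  LinearMap.mkContinuous
    { toFun := fun x => ⟨fun j => x (j - k), memℓp_two_iff.2
        ((Equiv.subRight k).summable_iff.2 (memℓp_two_iff.1 (lp.memℓp x)))⟩
      map_add' := fun x y => rfl
      map_smul' := fun a x => rfl } 1
    (fun x => by
      rw [one_mul]
      refine le_of_sq_le_sq ?_ (norm_nonneg _)
      rw [SqSumm.norm_sq, SqSumm.norm_sq]
      exact ((Equiv.subRight k).tsum_eq fun j => ‖x j‖ ^ 2).le)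

@[simp]
theorem shift_apply (k : ℤ) (x : SqSumm) (j : ℤ) : shift k x j = x (j - k) := rfl

theorem norm_shift_le (k : ℤ) : ‖shift k‖ ≤ 1 :=
  LinearMap.mkContinuous_norm_le _ zero_le_one _

theorem shift_zero : shift 0 = 1 := by
  ext x j
  simp

theorem shift_mul (k l : ℤ) : shift k * shift l = shift (k + l) := by
  ext x j
  simp [sub_sub]

theorem shift_pow (k : ℤ) (n : ℕ) : shift k ^ n = shift (n * k) := by
  induction n with
  | zero => simp [shift_zero]
  | succ n ih =>
    rw [pow_succ, ih, shift_mul]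
    congr 1
    push_cast
    ring

/-- Multiplication by an absolutely summable symbol. -/
def conv (g : ℤ → ℂ) : SqOp := ∑' k, g k • shift k

theorem summable_smul_shift {g : ℤ → ℂ} (hg : Summable fun k => ‖g k‖) :
    Summable fun k => g k • shift k := by
  refine Summable.of_norm_bounded hg fun k => ?_
  rw [norm_smul]
  exact mul_le_of_le_one_right (norm_nonneg _) (norm_shift_le k)

theorem conv_apply {g : ℤ → ℂ} (hg : Summable fun k => ‖g k‖) (x : SqSumm) :
    ⇑(conv g x) = cmul g x := by
  funext n
  let ev : SqOp →L[ℂ] ℂ :=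
    (lp.evalCLM ℂ (fun _ : ℤ => ℂ) 2 n).comp (ContinuousLinearMap.apply ℂ SqSumm x)
  have h : conv g x n = ∑' k, g k * x (n - k) :=
    ((summable_smul_shift hg).hasSum.mapL ev).tsum_eq.symm
  rw [h, cmul, ← (Equiv.subLeft n).tsum_eq]
  exact tsum_congr fun j => by simp

theorem conv_commute_shift {g : ℤ → ℂ} (hg : Summable fun k => ‖g k‖) (k : ℤ) :
    Commute (conv g) (shift k) := by
  rw [commute_iff_eq, conv, ← (summable_smul_shift hg).tsum_mul_right,
    ← (summable_smul_shift hg).tsum_mul_left]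
  exact tsum_congr fun j => by
    rw [smul_mul_assoc, mul_smul_comm, shift_mul, shift_mul, add_comm]

theorem conv_commute {g h : ℤ → ℂ} (hg : Summable fun k => ‖g k‖) (hh : Summable fun k => ‖h k‖) :
    Commute (conv g) (conv h) := by
  rw [commute_iff_eq, conv.eq_1 h, ← (summable_smul_shift hh).tsum_mul_right,
    ← (summable_smul_shift hh).tsum_mul_left]
  exact tsum_congr fun j => by
    rw [smul_mul_assoc, mul_smul_comm, (conv_commute_shift hg j).eq]

/-- The unit sequence at mode `0`, i.e. the constant function `1`. -/
def unitSeq : SqSumm := lp.single 2 (0 : ℤ) (1 : ℂ)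

theorem unitSeq_apply (j : ℤ) : unitSeq j = one1 j := by
  by_cases h : j = 0
  · subst h
    simp [unitSeq, one1]
  · simp [unitSeq, one1, h]

theorem cmul_unitSeq (g : ℤ → ℂ) : cmul g unitSeq = g := by
  funext n
  rw [cmul, tsum_eq_single 0]
  · simp [unitSeq_apply, one1]
  · intro j hj
    simp [unitSeq_apply, one1, hj]

/-- A bounded operator commuting with all translations is determined by its value at `1`. -/
theorem eq_of_commute_shift {X Y : SqOp} (hX : ∀ k, Commute X (shift k))
    (hY : ∀ k, Commute Y (shift k)) (h : X unitSeq = Y unitSeq) : X = Y := by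
  ext1 x
  have hx := lp.hasSum_single (p := 2) (by norm_num) x
  refine (hx.mapL X).unique ?_
  convert hx.mapL Y using 2 with k
  have hk : lp.single 2 k (x k) = x k • shift k unitSeq := by
    apply lp.ext
    funext j
    rw [lp.coeFn_smul, Pi.smul_apply, shift_apply, unitSeq_apply]
    by_cases hj : j = k
    · subst hj
      simp [one1]
    · simp [one1, hj, sub_eq_zero]
  rw [hk, map_smul, map_smul]
  congr 1
  have e1 : X (shift k unitSeq) = shift k (X unitSeq) := congrArg (· unitSeq) (hX k).eq
  have e2 : Y (shift k unitSeq) = shift k (Y unitSeq) := congrArg (· unitSeq) (hY k).eq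
  rw [e1, e2, h]

theorem restr_add_restr_compl (s : Set ℤ) (x : SqSumm) : restr s x + restr sᶜ x = x := by
  apply lp.ext
  funext j
  rw [lp.coeFn_add, Pi.add_apply, restr_apply, restr_apply]
  by_cases h : j ∈ s <;> simp [h]

theorem restr_eq_self {s : Set ℤ} {x : SqSumm} (h : ∀ j, j ∉ s → x j = 0) : restr s x = x := by
  apply lp.ext
  funext j
  rw [restr_apply]
  split_ifs with hj
  · rfl
  · exact (h j hj).symm

theorem restr_eq_zero {s : Set ℤ} {x : SqSumm} (h : ∀ j ∈ s, x j = 0) : restr s x = 0 := by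
  apply lp.ext
  funext j
  rw [restr_apply]
  split_ifs with hj
  · exact h j hj
  · rfl

theorem restr_apply_of_mem {s : Set ℤ} {j : ℤ} (x : SqSumm) (h : j ∈ s) : restr s x j = x j := by
  rw [restr_apply, if_pos h]

theorem restr_apply_of_notMem {s : Set ℤ} {j : ℤ} (x : SqSumm) (h : j ∉ s) :
    restr s x j = 0 := by
  rw [restr_apply, if_neg h]

/-- `X` maps sequences vanishing on some `S ∈ 𝒮` to sequences vanishing on `S`. -/
def PreservesVanishing (𝒮 : Set (Set ℤ)) (X : SqOp) : Prop :=
  ∀ S ∈ 𝒮, ∀ x : SqSumm, (∀ j ∈ S, x j = 0) → ∀ j ∈ S, X x j = 0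

theorem PreservesVanishing.of_mem_elemental {𝒮 : Set (Set ℤ)} {X Y : SqOp}
    (hX : PreservesVanishing 𝒮 X) (hY : Y ∈ Algebra.elemental ℂ X) : PreservesVanishing 𝒮 Y := by
  let A : Subalgebra ℂ SqOp :=
    { carrier := {Z | PreservesVanishing 𝒮 Z}
      mul_mem' := fun {a b} ha hb S hS x hx => ha S hS _ (hb S hS x hx)
      add_mem' := fun {a b} ha hb S hS x hx j hj => by
        change a x j + b x j = 0
        rw [ha S hS x hx j hj, hb S hS x hx j hj, add_zero]
      algebraMap_mem' := fun c S hS x hx j hj => by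
        change c * x j = 0
        rw [hx j hj, mul_zero] }
  have hclosed : IsClosed (A : Set SqOp) := by
    have : (A : Set SqOp) = ⋂ S ∈ 𝒮, ⋂ x ∈ {x : SqSumm | ∀ j ∈ S, x j = 0}, ⋂ j ∈ S,
        {Z : SqOp | lp.evalCLM ℂ (fun _ : ℤ => ℂ) 2 j (Z x) = 0} := by
      ext Z
      simp only [Set.mem_iInter]
      rfl
    rw [this]
    refine isClosed_biInter fun S _ => isClosed_biInter fun x _ => isClosed_biInter fun j _ => ?_
    exact isClosed_eq (by fun_prop) continuous_const
  exact Algebra.elemental.le_of_mem hclosed (show X ∈ A from hX) hY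

theorem preservesVanishing_shift_one : PreservesVanishing (Set.range Set.Iio) (shift 1) := by
  rintro _ ⟨m, rfl⟩ x hx j hj
  rw [shift_apply]
  exact hx _ (by simp only [Set.mem_Iio] at hj ⊢; omega)

theorem preservesVanishing_shift_neg_one :
    PreservesVanishing (Set.range Set.Ici) (shift (-1)) := by
  rintro _ ⟨m, rfl⟩ x hx j hj
  rw [shift_apply]
  exact hx _ (by simp only [Set.mem_Ici] at hj ⊢; omega)

/-- Elements of the algebra generated by the forward shift raise modes, up to a small error, by a
bounded amount only. -/
theorem exists_restr_le_of_mem_elemental_shift_one {X : SqOp}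
    (hX : X ∈ Algebra.elemental ℂ (shift 1)) {ε : ℝ} (hε : 0 < ε) :
    ∃ n₀ : ℕ, ∀ n : ℕ, n₀ ≤ n → ∀ x : SqSumm, (∀ j, -(n : ℤ) ≤ j → x j = 0) →
      ‖restr (Set.Ici 0) (X x)‖ ≤ ε * ‖x‖ := by
  have hpoly : ∀ Y ∈ Algebra.adjoin ℂ {shift 1}, ∃ d : ℕ, ∀ (m : ℤ) (x : SqSumm),
      (∀ j, m ≤ j → x j = 0) → ∀ j, m + d ≤ j → Y x j = 0 := by
    intro Y hY
    induction hY using Algebra.adjoin_induction with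
    | mem Y hY =>
      rw [Set.mem_singleton_iff] at hY
      subst hY
      exact ⟨1, fun m x hx j hj => hx _ (by push_cast at hj; omega)⟩
    | algebraMap c =>
      refine ⟨0, fun m x hx j hj => ?_⟩
      change c * x j = 0
      rw [hx j (by simpa using hj), mul_zero]
    | add Y Z _ _ hY hZ =>
      obtain ⟨d, hd⟩ := hY
      obtain ⟨e, he⟩ := hZ
      refine ⟨d + e, fun m x hx j hj => ?_⟩
      push_cast at hj
      change Y x j + Z x j = 0
      rw [hd m x hx j (by omega), he m x hx j (by omega), add_zero]
    | mul Y Z _ _ hY hZ =>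
      obtain ⟨d, hd⟩ := hY
      obtain ⟨e, he⟩ := hZ
      refine ⟨d + e, fun m x hx j hj => ?_⟩
      push_cast at hj
      exact hd (m + e) (Z x) (he m x hx) j (by omega)
  obtain ⟨Y, hY, hXY⟩ := Metric.mem_closure_iff.1 (show X ∈ closure _ from hX) ε hε
  obtain ⟨d, hd⟩ := hpoly Y hY
  refine ⟨d, fun n hn x hx => ?_⟩
  have hYx : restr (Set.Ici 0) (Y x) = 0 :=
    restr_eq_zero fun j hj => hd (-n) x hx j (by simp only [Set.mem_Ici] at hj; omega)
  have : restr (Set.Ici 0) (X x) = restr (Set.Ici 0) ((X - Y) x) := by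
    rw [sub_apply, map_sub, hYx, sub_zero]
  rw [this]
  refine (norm_restr_apply_le _ _).trans ((X - Y).le_of_opNorm_le ?_ x)
  rw [← dist_eq_norm]
  exact hXY.le

/-- Stability of the finite sections of the Toeplitz operator on negative modes whose symbol has the
Wiener–Hopf factorization `G = Φ * D`. Here `r` collects the modes of `G m` below the section. -/
theorem norm_le_of_factorization {G Φ B C D : SqOp} (hGC : G * C = Φ) (hΦB : Φ * B = 1)
    (hBΦ : B * Φ = 1) (hCD : C * D = 1) (hDC : D * C = 1) (hBC : Commute B C)
    (hΦ : PreservesVanishing (Set.range Set.Iio) Φ) (hBel : B ∈ Algebra.elemental ℂ (shift 1))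
    (hC : PreservesVanishing (Set.range Set.Ici) C)
    (hD : PreservesVanishing (Set.range Set.Ici) D) :
    ∃ (n₀ : ℕ) (K : ℝ), 0 ≤ K ∧ ∀ n : ℕ, n₀ ≤ n → ∀ m p f r R : SqSumm,
      (∀ j < -(n : ℤ), m j = 0) → (∀ j, 0 ≤ j → m j = 0) → (∀ j < 0, p j = 0) →
      (∀ j, -(n : ℤ) ≤ j → r j = 0) → (∀ j < 0, R j = 0) →
      p + G m = f + r + R → ‖m‖ ≤ K * ‖f‖ := by
  have hB := preservesVanishing_shift_one.of_mem_elemental hBel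
  set L : ℝ := ‖D‖ * ‖Φ‖ with hL
  have hL0 : 0 ≤ L := by positivity
  set ε : ℝ := 1 / (2 * (L * ‖C‖ + 1)) with hε
  have hε0 : 0 < ε := by positivity
  have hLε : L * ‖C‖ * ε ≤ 1 / 2 := by
    rw [hε, mul_one_div, div_le_div_iff₀ (by positivity) (by norm_num)]
    nlinarith [mul_nonneg hL0 (norm_nonneg C)]
  obtain ⟨n₀, hn₀⟩ := exists_restr_le_of_mem_elemental_shift_one hBel hε0
  refine ⟨n₀, ‖C‖ * ‖B‖ * (1 + 2 * (L * (‖C‖ * ‖B‖))), by positivity, ?_⟩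
  intro n hn m p f r R hm hm0 hp hr hR heq
  have hDm : D m = B (f + r + R - p) := by
    have hG : B * G = D := by
      calc B * G = B * (G * (C * D)) := by rw [hCD, mul_one]
        _ = B * (G * C) * D := by simp only [mul_assoc]
        _ = D := by rw [hGC, hBΦ, one_mul]
    rw [← hG, ← heq, add_sub_cancel_left]
    rfl
  set F : SqOp := restr (Set.Iio 0) with hF
  set E : SqOp := restr (Set.Ici 0) with hE
  set Q : SqOp := restr (Set.Iio (-(n : ℤ))) with hQ
  have hFDm : D m = F (B f) + F (B r) := by
    have h1 : F (D m) = D m := restr_eq_self fun j hj =>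
      hD _ ⟨0, rfl⟩ m (fun i hi => hm0 i hi) j (by simpa using hj)
    have h2 : F (B R) = 0 := restr_eq_zero (hB _ ⟨0, rfl⟩ R hR)
    have h3 : F (B p) = 0 := restr_eq_zero (hB _ ⟨0, rfl⟩ p hp)
    rw [← h1, hDm]
    simp only [map_sub, map_add, h2, h3, add_zero, sub_zero]
  have hmeq : m = C (F (B f)) + C (F (B r)) := by
    rw [← map_add, ← hFDm]
    exact (congrArg (· m) hCD).symm
  have hEF : ∀ x, F x + E x = x := fun x => by
    have := restr_add_restr_compl (Set.Iio 0) x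
    rwa [Set.compl_Iio] at this
  set y : SqSumm := C r with hy
  have hBy : B y = C (F (B r)) + C (E (B r)) := by
    rw [← map_add, hEF]
    exact congrArg (· r) hBC.eq
  have hQBy : Q (B y) = Q (C (E (B r))) - Q (C (F (B f))) := by
    have h1 : Q m = 0 := restr_eq_zero hm
    rw [hmeq, map_add] at h1
    rw [hBy, map_add, eq_neg_of_add_eq_zero_right h1]
    abel
  have hyQ : y = Q (Φ (Q (B y))) := by
    have h1 : Q y = y := restr_eq_self fun j hj =>
      hC _ ⟨-(n : ℤ), rfl⟩ r (fun i hi => hr i hi) j (by simpa using hj)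
    have h2 : Q (Φ (restr (Set.Iio (-(n : ℤ)))ᶜ (B y))) = 0 :=
      restr_eq_zero (hΦ _ ⟨_, rfl⟩ _ fun j hj => restr_apply_of_notMem _ (by simpa using hj))
    have h3 : Φ (B y) = y := congrArg (· y) hΦB
    rw [← add_zero (Q (Φ (Q (B y)))), ← h2, ← map_add, ← map_add, restr_add_restr_compl, h3, h1]
  have hr1 : r = D y := (congrArg (· r) hDC).symm
  have hbound : ‖r‖ ≤ L * (‖C‖ * (ε * ‖r‖) + ‖C‖ * (‖B‖ * ‖f‖)) := by
    have e1 : ‖Q (C (E (B r)))‖ ≤ ‖C‖ * (ε * ‖r‖) :=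
      (norm_restr_apply_le _ _).trans (C.le_opNorm_of_le (hn₀ n hn r hr))
    have e2 : ‖Q (C (F (B f)))‖ ≤ ‖C‖ * (‖B‖ * ‖f‖) :=
      (norm_restr_apply_le _ _).trans (C.le_opNorm_of_le
        ((norm_restr_apply_le _ _).trans (B.le_opNorm f)))
    have e3 : ‖Q (B y)‖ ≤ ‖C‖ * (ε * ‖r‖) + ‖C‖ * (‖B‖ * ‖f‖) := by
      rw [hQBy]
      exact (norm_sub_le _ _).trans (add_le_add e1 e2)
    have e4 : ‖y‖ ≤ ‖Φ‖ * (‖C‖ * (ε * ‖r‖) + ‖C‖ * (‖B‖ * ‖f‖)) := by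
      rw [hyQ]
      exact (norm_restr_apply_le _ _).trans (Φ.le_opNorm_of_le e3)
    calc ‖r‖ = ‖D y‖ := by rw [← hr1]
      _ ≤ ‖D‖ * (‖Φ‖ * (‖C‖ * (ε * ‖r‖) + ‖C‖ * (‖B‖ * ‖f‖))) := D.le_opNorm_of_le e4
      _ = _ := by rw [hL]; ring
  have hrf : ‖r‖ ≤ 2 * (L * (‖C‖ * ‖B‖)) * ‖f‖ := by
    have : L * ‖C‖ * ε * ‖r‖ ≤ 1 / 2 * ‖r‖ := by gcongr
    linarith
  have hCFB : ∀ x, ‖C (F (B x))‖ ≤ ‖C‖ * (‖B‖ * ‖x‖) := fun x =>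
    C.le_opNorm_of_le ((norm_restr_apply_le _ _).trans (B.le_opNorm x))
  calc ‖m‖ ≤ ‖C‖ * (‖B‖ * ‖f‖) + ‖C‖ * (‖B‖ * ‖r‖) := by
        rw [hmeq]
        exact (norm_add_le _ _).trans (add_le_add (hCFB f) (hCFB r))
    _ ≤ ‖C‖ * (‖B‖ * ‖f‖) + ‖C‖ * (‖B‖ * (2 * (L * (‖C‖ * ‖B‖)) * ‖f‖)) := by gcongr
    _ = _ := by ring

theorem sum_sq_tail_le {a T : ℕ → ℝ} (hT : ∀ k, T k = a (k + 1) + T (k + 1)) (n : ℕ) :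
    ∑ k ∈ Finset.range n, T k ^ 2 ≤
      2 * n * T n ^ 2 + 4 * ∑ k ∈ Finset.range n, ((k + 1 : ℕ) : ℝ) ^ 2 * a (k + 1) ^ 2 := by
  induction n with
  | zero => simp
  | succ n ih =>
    rw [Finset.sum_range_succ, Finset.sum_range_succ, mul_add]
    have h := hT n
    push_cast
    rw [h] at ih ⊢
    have hn : (0 : ℝ) ≤ n := n.cast_nonneg
    push_cast at ih
    nlinarith [sq_nonneg (T (n + 1) - (2 * n + 1) * a (n + 1)), sq_nonneg (a (n + 1)),
      mul_nonneg hn (sq_nonneg (a (n + 1)))]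

/-- Hardy's inequality for tails, in qualitative form. -/
theorem summable_sq_tail {a : ℕ → ℝ} (ha0 : ∀ k, 0 ≤ a k) (ha : Summable a)
    (ha2 : Summable fun k : ℕ => (k : ℝ) ^ 2 * a k ^ 2) :
    Summable fun k : ℕ => (∑' i, a (k + 1 + i)) ^ 2 := by
  set K := ∑' k : ℕ, (k : ℝ) ^ 2 * a k ^ 2
  refine summable_of_sum_range_le (c := 4 * K) (fun _ => sq_nonneg _) fun n => ?_
  have hlim : Filter.Tendsto
      (fun M => ∑ k ∈ Finset.range n, (∑ j ∈ Finset.Ico (k + 1) M, a j) ^ 2) Filter.atTop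
      (nhds (∑ k ∈ Finset.range n, (∑' i, a (k + 1 + i)) ^ 2)) := by
    refine tendsto_finsetSum _ fun k _ => Filter.Tendsto.pow ?_ 2
    simp only [Finset.sum_Ico_eq_sum_range]
    have hs : Summable fun i => a (k + 1 + i) := by
      simpa only [add_comm] using (summable_nat_add_iff (k + 1)).2 ha
    exact hs.hasSum.tendsto_sum_nat.comp (Filter.tendsto_sub_atTop_nat (k + 1))
  refine le_of_tendsto hlim (Filter.eventually_atTop.2 ⟨n, fun M hM => ?_⟩)
  have h := sum_sq_tail_le (a := fun j => if j < M then a j else 0)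
    (T := fun k => ∑ j ∈ Finset.Ico (k + 1) M, a j) (fun k => by
      by_cases hk : k + 1 < M
      · simp only [hk, if_true]
        exact Finset.sum_eq_sum_Ico_succ_bot hk _
      · simp only [hk, if_false]
        rw [Finset.Ico_eq_empty_of_le (by omega), Finset.Ico_eq_empty_of_le (by omega)]
        simp) M
  calc ∑ k ∈ Finset.range n, (∑ j ∈ Finset.Ico (k + 1) M, a j) ^ 2
      ≤ ∑ k ∈ Finset.range M, (∑ j ∈ Finset.Ico (k + 1) M, a j) ^ 2 :=
        Finset.sum_le_sum_of_subset_of_nonneg (Finset.range_subset_range.2 hM)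
          fun _ _ _ => sq_nonneg _
    _ ≤ 4 * ∑ k ∈ Finset.range M, ((k + 1 : ℕ) : ℝ) ^ 2 *
          (if k + 1 < M then a (k + 1) else 0) ^ 2 := by simpa using h
    _ ≤ 4 * ∑ k ∈ Finset.range M, ((k + 1 : ℕ) : ℝ) ^ 2 * a (k + 1) ^ 2 := by
        gcongr with k hk
        · split_ifs <;> simp [ha0]
        · split_ifs
          · exact le_rfl
          · exact ha0 _
    _ ≤ 4 * K := by
        gcongr
        exact ((summable_nat_add_iff 1).2 ha2).sum_le_tsum _ (fun _ _ => by positivity) |>.trans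
          (by
            have := ha2.sum_add_tsum_nat_add 1
            simp only [Finset.range_one, Finset.sum_singleton] at this
            norm_num at this ⊢
            exact this.le)

/-- Division of a power series with a zero `ζ` in the closed disk by `z - ζ`. -/
theorem exists_sqSummable_div_sub {p : ℕ → ℂ} (hp : Summable fun k => ‖p k‖)
    (hp2 : Summable fun k : ℕ => (k : ℝ) ^ 2 * ‖p k‖ ^ 2) {ζ : ℂ} (hζ : ‖ζ‖ ≤ 1)
    (h0 : ∑' k, p k * ζ ^ k = 0) :
    ∃ r : ℕ → ℂ, (Summable fun k => ‖r k‖ ^ 2) ∧ p 0 = -ζ * r 0 ∧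
      ∀ k, p (k + 1) = r k - ζ * r (k + 1) := by
  have hle : ∀ (a : ℂ) (i : ℕ), ‖a * ζ ^ i‖ ≤ ‖a‖ := fun a i => by
    rw [norm_mul, norm_pow]
    exact mul_le_of_le_one_right (norm_nonneg _) (pow_le_one₀ (norm_nonneg _) hζ)
  have hshift : ∀ k, Summable fun i => ‖p (k + i)‖ := fun k => by
    simpa only [add_comm] using (summable_nat_add_iff k).2 hp
  have hs : ∀ k, Summable fun i => p (k + i) * ζ ^ i := fun k =>
    Summable.of_norm_bounded (hshift k) fun i => hle _ i
  have hrec : ∀ k, ∑' i, p (k + i) * ζ ^ i = p k + ζ * ∑' i, p (k + 1 + i) * ζ ^ i := by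
    intro k
    rw [(hs k).tsum_eq_zero_add, ← tsum_mul_left]
    congr 1
    · simp
    · exact tsum_congr fun i => by
        rw [show k + (i + 1) = k + 1 + i by ring, pow_succ]
        ring
  refine ⟨fun k => ∑' i, p (k + 1 + i) * ζ ^ i, ?_, ?_, fun k => ?_⟩
  · refine (summable_sq_tail (fun k => norm_nonneg (p k)) hp hp2).of_nonneg_of_le
      (fun _ => sq_nonneg _) fun k => ?_
    gcongr
    exact tsum_of_norm_bounded (hshift (k + 1)).hasSum fun i => hle _ i
  · have := hrec 0
    simp only [zero_add] at this ⊢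
    rw [h0] at this
    linear_combination -this
  · have := hrec (k + 1)
    linear_combination -this

/-- Division of a power series by `1 - ζ z`, where on the unit circle the zero of the denominator is
a zero of the series. -/
theorem exists_sqSummable_div_one_sub {p : ℕ → ℂ} (hp : Summable fun k => ‖p k‖)
    (hp2 : Summable fun k : ℕ => (k : ℝ) ^ 2 * ‖p k‖ ^ 2) {ζ : ℂ} (hζ : ‖ζ‖ ≤ 1)
    (h0 : ‖ζ‖ = 1 → ∑' k, p k * ζ⁻¹ ^ k = 0) :
    ∃ r : ℕ → ℂ, (Summable fun k => ‖r k‖ ^ 2) ∧ p 0 = r 0 ∧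
      ∀ k, p (k + 1) = r (k + 1) - ζ * r k := by
  rcases hζ.eq_or_lt with h1 | h1
  · have hne : ζ ≠ 0 := by
      rw [← norm_pos_iff, h1]
      exact one_pos
    obtain ⟨r, hr, hr0, hrs⟩ := exists_sqSummable_div_sub hp hp2 (ζ := ζ⁻¹) (by simp [h1]) (h0 h1)
    refine ⟨fun k => -ζ⁻¹ * r k, ?_, hr0, fun k => ?_⟩
    · simpa [h1] using hr
    · rw [hrs k]
      field_simp
      ring
  · let r : ℕ → ℂ := fun k => Nat.rec (p 0) (fun k rk => p (k + 1) + ζ * rk) k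
    have hrs : ∀ k, r (k + 1) = p (k + 1) + ζ * r k := fun k => rfl
    refine ⟨r, ?_, rfl, fun k => by rw [hrs]; ring⟩
    have hpsq : Summable fun k => ‖p k‖ ^ 2 := by
      refine (summable_nat_add_iff 1).1 ?_
      refine ((summable_nat_add_iff 1).2 hp2).of_nonneg_of_le (fun _ => sq_nonneg _) fun k => ?_
      refine le_mul_of_one_le_left (sq_nonneg _) (one_le_pow₀ ?_)
      push_cast
      linarith [(k.cast_nonneg : (0 : ℝ) ≤ k)]
    set ρ := ‖ζ‖
    have hρ : 0 < 1 - ρ := by linarith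
    have hρ0 : 0 ≤ ρ := norm_nonneg _
    set W := (∑' k, ‖p k‖ ^ 2) / (1 - ρ) with hW
    have hW0 : 0 ≤ W := by
      have : 0 ≤ ∑' k, ‖p k‖ ^ 2 := tsum_nonneg fun _ => sq_nonneg _
      positivity
    have hstep : ∀ k, ‖r (k + 1)‖ ^ 2 ≤ ‖p (k + 1)‖ ^ 2 / (1 - ρ) + ρ * ‖r k‖ ^ 2 := by
      intro k
      have h2 : ‖r (k + 1)‖ ≤ ‖p (k + 1)‖ + ρ * ‖r k‖ := by
        rw [hrs, ← norm_mul]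
        exact norm_add_le _ _
      refine (pow_le_pow_left₀ (norm_nonneg _) h2 2).trans ?_
      rw [← sub_nonneg]
      have : ‖p (k + 1)‖ ^ 2 / (1 - ρ) + ρ * ‖r k‖ ^ 2 - (‖p (k + 1)‖ + ρ * ‖r k‖) ^ 2 =
          ρ / (1 - ρ) * (‖p (k + 1)‖ - (1 - ρ) * ‖r k‖) ^ 2 := by
        field_simp
        ring
      rw [this]
      positivity
    have hsum : ∀ n, ∑ k ∈ Finset.range (n + 1), ‖r k‖ ^ 2 ≤
        (∑ k ∈ Finset.range (n + 1), ‖p k‖ ^ 2) / (1 - ρ) +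
          ρ * ∑ k ∈ Finset.range n, ‖r k‖ ^ 2 := by
      intro n
      induction n with
      | zero =>
        simp only [zero_add, Finset.range_one, Finset.sum_singleton, Finset.range_zero,
          Finset.sum_empty, mul_zero, add_zero]
        rw [le_div_iff₀ hρ]
        exact mul_le_of_le_one_right (sq_nonneg _) (by linarith)
      | succ n ih =>
        rw [Finset.sum_range_succ, Finset.sum_range_succ _ (n + 1), Finset.sum_range_succ _ n,
          add_div]
        rw [Finset.sum_range_succ _ n] at ih
        linarith [hstep n]
    refine summable_of_sum_range_le (c := W / (1 - ρ)) (fun _ => sq_nonneg _) fun n => ?_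
    have hn := hsum n
    have hpn : (∑ k ∈ Finset.range (n + 1), ‖p k‖ ^ 2) / (1 - ρ) ≤ W := by
      rw [hW]
      gcongr
      exact hpsq.sum_le_tsum _ fun _ _ => sq_nonneg _
    rw [le_div_iff₀ hρ]
    rw [Finset.sum_range_succ] at hn
    nlinarith [sq_nonneg ‖r n‖]

/-- Extension by zero of a one-sided square-summable sequence to the nonnegative modes. -/
theorem exists_sqSumm_nonneg_modes {r : ℕ → ℂ} (hr : Summable fun k => ‖r k‖ ^ 2) :
    ∃ x : SqSumm, (∀ k : ℕ, x k = r k) ∧ ∀ j < 0, x j = 0 := by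
  let f : ℤ → ℂ := fun j => if 0 ≤ j then r j.toNat else 0
  have hf : Memℓp f 2 := by
    rw [memℓp_two_iff]
    refine Summable.of_nat_of_neg ?_ ?_
    · simpa [f] using hr
    · refine summable_of_ne_finset_zero (s := {0}) fun k hk => ?_
      have : ¬ (0 : ℤ) ≤ -(k : ℤ) := by
        have : k ≠ 0 := by simpa using hk
        omega
      simp only [f, if_neg this]
      simp
  refine ⟨⟨f, hf⟩, fun k => ?_, fun j hj => ?_⟩
  · simp [f]
  · simp [f, not_le.2 hj]

theorem memℓp_comp_equiv {u : ℤ → ℂ} (hu : Memℓp u 2) (e : ℤ ≃ ℤ) :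
    Memℓp (fun j => u (e j)) 2 :=
  memℓp_two_iff.2 (e.summable_iff.2 (memℓp_two_iff.1 hu))

/-- Extension by zero of a one-sided square-summable sequence to the negative modes. -/
theorem exists_sqSumm_neg_modes {r : ℕ → ℂ} (hr : Summable fun k => ‖r k‖ ^ 2) :
    ∃ x : SqSumm, (∀ k : ℕ, x (-1 - k) = r k) ∧ ∀ j, 0 ≤ j → x j = 0 := by
  obtain ⟨x, hx, hx0⟩ := exists_sqSumm_nonneg_modes hr
  refine ⟨⟨_, memℓp_comp_equiv (lp.memℓp x) (Equiv.subLeft (-1))⟩, fun k => ?_,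
    fun j hj => hx0 _ (by simp only [Equiv.subLeft_apply]; omega)⟩
  rw [← hx k]
  exact congrArg x (sub_sub_cancel _ _)

theorem eq_zero_of_norm_le_succ {x : SqSumm} (h : ∀ j, ‖x j‖ ≤ ‖x (j + 1)‖) : x = 0 := by
  apply lp.ext
  funext j
  have hle : ∀ k : ℕ, ‖x j‖ ≤ ‖x (j + k)‖ := by
    intro k
    induction k with
    | zero => simp
    | succ k ih =>
      refine ih.trans ((h _).trans_eq ?_)
      push_cast
      rw [add_assoc]
  have hs := (memℓp_two_iff.1 (lp.memℓp x)).comp_injective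
    (i := fun k : ℕ => j + (k : ℤ)) (fun a b hab => by simpa using hab)
  have h0 : ‖x j‖ ^ 2 ≤ 0 := ge_of_tendsto hs.tendsto_atTop_zero (Filter.Eventually.of_forall
    fun k => pow_le_pow_left₀ (norm_nonneg _) (hle k) 2)
  have : ‖x j‖ = 0 := by nlinarith [norm_nonneg (x j)]
  simpa using this

theorem eq_zero_of_norm_le_pred {x : SqSumm} (h : ∀ j, ‖x j‖ ≤ ‖x (j - 1)‖) : x = 0 := by
  have hmem : Memℓp (fun j : ℤ => x (-j)) 2 := memℓp_comp_equiv (lp.memℓp x) (Equiv.neg ℤ)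
  have h0 : (⟨_, hmem⟩ : SqSumm) = 0 := eq_zero_of_norm_le_succ fun j => by
    change ‖x (-j)‖ ≤ ‖x (-(j + 1))‖
    rw [neg_add, ← sub_eq_add_neg]
    exact h _
  apply lp.ext
  funext j
  have : x (- -j) = 0 := congrArg (fun y : SqSumm => y (-j)) h0
  rwa [neg_neg] at this

theorem shift_one_sub_smul_injective {ζ : ℂ} (hζ : ‖ζ‖ ≤ 1) {x : SqSumm}
    (hx : (shift 1 - ζ • (1 : SqOp)) x = 0) : x = 0 := by
  refine eq_zero_of_norm_le_succ fun j => ?_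
  have h : x (j + 1 - 1) - ζ * x (j + 1) = 0 := congrArg (fun y : SqSumm => y (j + 1)) hx
  rw [add_sub_cancel_right, sub_eq_zero] at h
  rw [h, norm_mul]
  exact mul_le_of_le_one_left (norm_nonneg _) hζ

theorem one_sub_smul_shift_one_injective {ζ : ℂ} (hζ : ‖ζ‖ ≤ 1) {x : SqSumm}
    (hx : ((1 : SqOp) - ζ • shift 1) x = 0) : x = 0 := by
  refine eq_zero_of_norm_le_pred fun j => ?_
  have h : x j - ζ * x (j - 1) = 0 := congrArg (fun y : SqSumm => y j) hx
  rw [sub_eq_zero] at h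
  rw [h, norm_mul]
  exact mul_le_of_le_one_left (norm_nonneg _) hζ

/-- Uniqueness for the homogeneous Riemann–Hilbert problem forces both factors `P`, `M` of a
factorization `P = g M` to be zero-free in the closed unit disk and its exterior, respectively. -/
theorem factors_ne_zero {g : ℤ → ℂ} (hg : Summable fun k => ‖g k‖) {P M : SqSumm}
    (hP0 : ∀ j < 0, P j = 0) (hM0 : ∀ j > 0, M j = 0) (hgM : conv g M = P) (hM : M ≠ 0)
    (hP1 : Summable fun k : ℕ => ‖P k‖) (hP2 : Summable fun k : ℕ => (k : ℝ) ^ 2 * ‖P k‖ ^ 2)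
    (hM1 : Summable fun k : ℕ => ‖M (-k)‖)
    (hM2 : Summable fun k : ℕ => (k : ℝ) ^ 2 * ‖M (-k)‖ ^ 2)
    (huniq : ∀ x y : SqSumm, (∀ j < 0, x j = 0) → (∀ j, 0 ≤ j → y j = 0) → x = conv g y → y = 0)
    (hcircle : ∀ ζ : ℂ, ‖ζ‖ = 1 →
      (∑' k : ℕ, P k * ζ ^ k = 0 ↔ ∑' k : ℕ, M (-k) * ζ⁻¹ ^ k = 0)) :
    (∀ ζ : ℂ, ‖ζ‖ ≤ 1 → ∑' k : ℕ, P k * ζ ^ k ≠ 0) ∧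
      ∀ ζ : ℂ, ‖ζ‖ ≤ 1 → ∑' k : ℕ, M (-k) * ζ ^ k ≠ 0 := by
  have key : ∀ (E : SqOp) (x y : SqSumm), (∀ z, E z = 0 → z = 0) → Commute E (conv g) →
      (∀ j < 0, x j = 0) → (∀ j, 0 ≤ j → y j = 0) → E x = P → E y = M → False := by
    intro E x y hE hcomm hx hy hxP hyM
    have hxy : x = conv g y := by
      refine sub_eq_zero.1 (hE _ ?_)
      have : E (conv g y) = conv g (E y) := congrArg (· y) hcomm.eq
      rw [map_sub, this, hxP, hyM, hgM, sub_self]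
    refine hM ?_
    rw [← hyM, huniq x y hx hy hxy, map_zero]
  have hcases : ∀ {Q : ℤ → Prop}, Q 0 → (∀ k : ℕ, Q (k + 1)) → (∀ k : ℕ, Q (-1 - k)) →
      ∀ j, Q j := by
    intro Q h0 hp hn j
    rcases lt_trichotomy j 0 with h | h | h
    · obtain ⟨k, hk⟩ := Int.eq_ofNat_of_zero_le (show 0 ≤ -j - 1 by omega)
      have : j = -1 - (k : ℤ) := by omega
      exact this ▸ hn k
    · exact h ▸ h0
    · obtain ⟨k, hk⟩ := Int.eq_ofNat_of_zero_le (show 0 ≤ j - 1 by omega)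
      have : j = (k : ℤ) + 1 := by omega
      exact this ▸ hp k
  constructor
  · intro ζ hζ h0
    obtain ⟨r, hr, hr0, hrs⟩ := exists_sqSummable_div_sub hP1 hP2 hζ h0
    obtain ⟨q, hq, hq0, hqs⟩ := exists_sqSummable_div_one_sub hM1 hM2 hζ
      fun h => (hcircle ζ h).1 h0
    obtain ⟨x, hx, hx0⟩ := exists_sqSumm_nonneg_modes hr
    obtain ⟨y, hy, hy0⟩ := exists_sqSumm_neg_modes hq
    refine key (shift 1 - ζ • (1 : SqOp)) x y (fun z => shift_one_sub_smul_injective hζ)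
      (((conv_commute_shift hg 1).symm).sub_left ((Commute.one_left _).smul_left ζ)) hx0 hy0 ?_ ?_
    · apply lp.ext
      funext j
      change x (j - 1) - ζ * x j = P j
      revert j
      refine hcases ?_ (fun k => ?_) fun k => ?_
      · have h1 := hx 0
        push_cast at h1 hr0
        rw [hx0 _ (by norm_num), h1, hr0]
        ring
      · have h1 := hx (k + 1)
        have h2 := hrs k
        push_cast at h1 h2
        rw [add_sub_cancel_right, hx, h1, h2]
      · rw [hx0 _ (by omega), hx0 _ (by omega), hP0 _ (by omega)]
        ring
    · apply lp.ext
      funext j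
      change y (j - 1) - ζ * y j = M j
      revert j
      refine hcases ?_ (fun k => ?_) fun k => ?_
      · have h1 := hy 0
        push_cast at h1 hq0
        rw [neg_zero] at hq0
        rw [hy0 0 le_rfl, zero_sub, hq0, ← h1]
        norm_num
      · rw [hy0 _ (by omega), hy0 _ (by omega), hM0 _ (by omega)]
        ring
      · have h2 := hqs k
        rw [Nat.cast_add_one, neg_add_rev, ← sub_eq_add_neg] at h2
        rw [h2, ← hy k, ← hy (k + 1)]
        push_cast
        rw [sub_sub]
  · intro ζ hζ h0
    obtain ⟨r, hr, hr0, hrs⟩ := exists_sqSummable_div_one_sub hP1 hP2 hζ fun h => by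
      refine (hcircle ζ⁻¹ (by simp [h])).2 ?_
      rwa [inv_inv]
    obtain ⟨q, hq, hq0, hqs⟩ := exists_sqSummable_div_sub hM1 hM2 hζ h0
    obtain ⟨x, hx, hx0⟩ := exists_sqSumm_nonneg_modes hr
    obtain ⟨y, hy, hy0⟩ := exists_sqSumm_neg_modes hq
    refine key ((1 : SqOp) - ζ • shift 1) x y (fun z => one_sub_smul_shift_one_injective hζ)
      ((Commute.one_left _).sub_left ((conv_commute_shift hg 1).symm.smul_left ζ)) hx0 hy0 ?_ ?_
    · apply lp.ext
      funext j
      change x j - ζ * x (j - 1) = P j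
      revert j
      refine hcases ?_ (fun k => ?_) fun k => ?_
      · have h1 := hx 0
        push_cast at h1 hr0
        rw [hx0 (0 - 1) (by norm_num), h1, hr0]
        ring
      · have h1 := hx (k + 1)
        have h2 := hrs k
        push_cast at h1 h2
        rw [add_sub_cancel_right, hx, h1, h2]
      · rw [hx0 _ (by omega), hx0 _ (by omega), hP0 _ (by omega)]
        ring
    · apply lp.ext
      funext j
      change y j - ζ * y (j - 1) = M j
      revert j
      refine hcases ?_ (fun k => ?_) fun k => ?_
      · have h1 := hy 0
        push_cast at h1 hq0
        rw [neg_zero] at hq0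
        rw [hy0 0 le_rfl, zero_sub, zero_sub, hq0, ← h1, neg_mul]
      · rw [hy0 _ (by omega), hy0 _ (by omega), hM0 _ (by omega)]
        ring
      · have h2 := hqs k
        rw [Nat.cast_add_one, neg_add_rev, ← sub_eq_add_neg] at h2
        rw [h2, ← hy k, ← hy (k + 1)]
        push_cast
        rw [sub_sub]

instance : Nontrivial SqSumm :=
  ⟨unitSeq, 0, fun h => by
    have h0 : unitSeq 0 = (0 : SqSumm) 0 := by rw [h]
    rw [unitSeq_apply] at h0
    simp [one1] at h0⟩

theorem tsum_int_eq_tsum_nat {E : Type*} [AddCommMonoid E] [TopologicalSpace E] {f : ℤ → E}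
    (hf : ∀ j < 0, f j = 0) : ∑' j, f j = ∑' k : ℕ, f k :=
  (Function.Injective.tsum_eq Nat.cast_injective fun j hj =>
    ⟨j.toNat, Int.toNat_of_nonneg (not_lt.1 fun h => hj (hf j h))⟩).symm

theorem tsum_int_eq_tsum_nat_neg {E : Type*} [AddCommMonoid E] [TopologicalSpace E] {f : ℤ → E}
    (hf : ∀ j > 0, f j = 0) : ∑' j, f j = ∑' k : ℕ, f (-k) := by
  rw [← (Equiv.neg ℤ).tsum_eq]
  exact tsum_int_eq_tsum_nat fun j hj => hf _ (by simpa using hj)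

theorem tsum_cmul_mul_zpow {g h : ℤ → ℂ} (hg : Summable fun k => ‖g k‖)
    (hh : Summable fun k => ‖h k‖) {ζ : ℂ} (hζ : ‖ζ‖ = 1) :
    ∑' n, cmul g h n * ζ ^ n = (∑' k, g k * ζ ^ k) * ∑' k, h k * ζ ^ k := by
  have hne : ζ ≠ 0 := by
    rw [← norm_pos_iff, hζ]
    exact one_pos
  have hn : ∀ {f : ℤ → ℂ}, (Summable fun k => ‖f k‖) → Summable fun k => ‖f k * ζ ^ k‖ :=
    fun hf => by simpa [norm_zpow, hζ] using hf
  rw [tsum_mul_tsum_of_summable_norm (hn hg) (hn hh)]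
  let e : ℤ × ℤ ≃ ℤ × ℤ :=
    { toFun := fun x => (x.1 - x.2, x.2)
      invFun := fun x => (x.1 + x.2, x.2)
      left_inv := fun x => by simp
      right_inv := fun x => by simp }
  have hs := e.summable_iff.2 (summable_mul_of_summable_norm (hn hg) (hn hh))
  rw [← e.tsum_eq]
  have h2 := hs.tsum_prod
  simp only [Function.comp_def] at h2
  rw [h2]
  refine tsum_congr fun n => ?_
  rw [cmul, ← tsum_mul_right]
  refine tsum_congr fun j => ?_
  change g (n - j) * h j * ζ ^ n = g (n - j) * ζ ^ (n - j) * (h j * ζ ^ j)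
  rw [show ζ ^ n = ζ ^ (n - j) * ζ ^ j by rw [← zpow_add₀ hne, sub_add_cancel]]
  ring

theorem nonvanishing.tsum_ne_zero {g : ℤ → ℂ} (hg : nonvanishing g) {ζ : ℂ} (hζ : ‖ζ‖ = 1) :
    ∑' k, g k * ζ ^ k ≠ 0 := by
  obtain ⟨ε, hε, h⟩ := hg
  obtain ⟨θ, rfl⟩ := (Complex.norm_eq_one_iff ζ).1 hζ
  have h1 := h θ
  have h2 : ∀ j : ℤ, Complex.exp (Complex.I * j * θ) = Complex.exp (θ * Complex.I) ^ j := by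
    intro j
    rw [← Complex.exp_int_mul]
    congr 1
    ring
  simp only [h2] at h1
  intro h0
  rw [h0, norm_zero] at h1
  exact absurd h1 (not_le.2 hε)

/-- Stability of finite sections on negative modes for a symbol `g` with a factorization `P = g M`,
assuming uniqueness for the homogeneous Riemann–Hilbert problem. -/
theorem exists_stability_bound {g : ℤ → ℂ} (hg : Summable fun k => ‖g k‖) (hnv : nonvanishing g)
    {P M : SqSumm} (hP0 : ∀ j < 0, P j = 0) (hM0 : ∀ j > 0, M j = 0) (hgM : conv g M = P)
    (hM : M ≠ 0) (hP1 : Summable fun j => ‖P j‖)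
    (hP2 : Summable fun j : ℤ => (j : ℝ) ^ 2 * ‖P j‖ ^ 2)
    (hM1 : Summable fun j => ‖M j‖) (hM2 : Summable fun j : ℤ => (j : ℝ) ^ 2 * ‖M j‖ ^ 2)
    (huniq : ∀ x y : SqSumm, (∀ j < 0, x j = 0) → (∀ j, 0 ≤ j → y j = 0) → x = conv g y → y = 0) :
    ∃ (n₀ : ℕ) (K : ℝ), 0 ≤ K ∧ ∀ n : ℕ, n₀ ≤ n → ∀ m p f r R : SqSumm,
      (∀ j < -(n : ℤ), m j = 0) → (∀ j, 0 ≤ j → m j = 0) → (∀ j < 0, p j = 0) →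
      (∀ j, -(n : ℤ) ≤ j → r j = 0) → (∀ j < 0, R j = 0) →
      p + conv g m = f + r + R → ‖m‖ ≤ K * ‖f‖ := by
  have hcast : Function.Injective fun k : ℕ => (k : ℤ) := Nat.cast_injective
  have hneg : Function.Injective fun k : ℕ => -(k : ℤ) := neg_injective.comp hcast
  have hP1' : Summable fun k : ℕ => ‖P k‖ := hP1.comp_injective hcast
  have hM1' : Summable fun k : ℕ => ‖M (-k)‖ := hM1.comp_injective hneg
  obtain ⟨hPne, hMne⟩ := factors_ne_zero hg hP0 hM0 hgM hM hP1'
    (by simpa [Function.comp_def] using hP2.comp_injective hcast) hM1' (by simpa [Function.comp_def] using hM2.comp_injective hneg)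
    huniq fun ζ hζ => by
      have h := tsum_cmul_mul_zpow hg hM1 hζ
      rw [← conv_apply hg, hgM] at h
      rw [tsum_int_eq_tsum_nat (fun j hj => by rw [hP0 j hj, zero_mul]),
        tsum_int_eq_tsum_nat_neg (f := fun j => M j * ζ ^ j)
          (fun j hj => by rw [hM0 j hj, zero_mul])] at h
      simp only [zpow_neg, zpow_natCast, ← inv_pow] at h
      rw [h, mul_eq_zero, or_iff_right (hnv.tsum_ne_zero hζ)]
  have hΦ : conv P = ∑' k : ℕ, P k • shift 1 ^ k := by
    rw [conv, tsum_int_eq_tsum_nat (fun j hj => by rw [hP0 j hj, zero_smul])]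
    simp only [shift_pow, mul_one]
  have hC : conv M = ∑' k : ℕ, M (-k) • shift (-1) ^ k := by
    rw [conv, tsum_int_eq_tsum_nat_neg (fun j hj => by rw [hM0 j hj, zero_smul])]
    simp only [shift_pow, mul_neg, mul_one]
  obtain ⟨hΦel, B, hBel, hΦB, hBΦ⟩ :=
    exists_inverse_mem_elemental (shift 1) (norm_shift_le 1) _ hP1' hPne
  obtain ⟨hCel, D, hDel, hCD, hDC⟩ :=
    exists_inverse_mem_elemental (shift (-1)) (norm_shift_le (-1)) _ hM1' hMne
  rw [← hΦ] at hΦel hΦB hBΦ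
  rw [← hC] at hCel hCD hDC
  have hGC : conv g * conv M = conv P := by
    refine eq_of_commute_shift
      (fun k => (conv_commute_shift hg k).mul_left (conv_commute_shift hM1 k))
      (conv_commute_shift hP1) ?_
    have e1 : conv M unitSeq = M := lp.ext (by rw [conv_apply hM1, cmul_unitSeq])
    have e2 : conv P unitSeq = P := lp.ext (by rw [conv_apply hP1, cmul_unitSeq])
    change conv g (conv M unitSeq) = _
    rw [e1, e2, hgM]
  have hBC : Commute B (conv M) := by
    have h := (conv_commute hP1 hM1).eq
    calc B * conv M = B * (conv M * conv P) * B := by rw [mul_assoc, mul_assoc, hΦB, mul_one]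
      _ = conv M * B := by rw [← h, ← mul_assoc, hBΦ, one_mul]
  exact norm_le_of_factorization hGC hΦB hBΦ hCD hDC hBC
    (preservesVanishing_shift_one.of_mem_elemental hΦel) hBel
    (preservesVanishing_shift_neg_one.of_mem_elemental hCel)
    (preservesVanishing_shift_neg_one.of_mem_elemental hDel)

/-- The modes kept by `𝒫_N`. -/
def modes (N : ℕ) : Set ℤ := {j | -Nmin N ≤ j ∧ j ≤ Npl N}

/-- The finite section operator `𝒞⁺ - 𝓜_N(g)𝒞⁻` on square-summable sequences. -/
def sectionOp (g : ℤ → ℂ) (N : ℕ) : SqOp :=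
  restr (Set.Ici 0) +
    restr (modes N) * (conv g * (restr (modes N) * restr (Set.Iio 0)))

theorem coe_restr_modes (N : ℕ) (x : SqSumm) : ⇑(restr (modes N) x) = projP N x := by
  funext j
  by_cases h : j ∈ modes N
  · rw [restr_apply_of_mem x h]
    exact (if_pos h).symm
  · rw [restr_apply_of_notMem x h]
    exact (if_neg h).symm

theorem coe_restr_Ici (x : SqSumm) : ⇑(restr (Set.Ici 0) x) = Cpl x := by
  funext j
  rw [restr_apply, Cpl]
  by_cases h : 0 ≤ j <;> simp [h]

theorem coe_neg_restr_Iio (x : SqSumm) : ⇑(-restr (Set.Iio 0) x) = Cmn x := by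
  funext j
  rw [lp.coeFn_neg, Pi.neg_apply, restr_apply, Cmn]
  by_cases h : j < 0 <;> simp [h]

theorem coe_sectionOp {g : ℤ → ℂ} (hg : Summable fun k => ‖g k‖) (N : ℕ) (w : SqSumm) :
    ⇑(sectionOp g N w) = Cpl w - projP N (cmul g (projP N (Cmn w))) := by
  rw [← coe_neg_restr_Iio, ← coe_restr_Ici, ← coe_restr_modes, ← conv_apply hg, ← coe_restr_modes,
    ← lp.coeFn_sub]
  simp only [map_neg, sub_neg_eq_add]
  rfl

theorem restr_comm (s t : Set ℤ) (x : SqSumm) : restr s (restr t x) = restr t (restr s x) := by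
  apply lp.ext
  funext j
  simp only [restr_apply]
  split_ifs <;> rfl

theorem restr_restr (s : Set ℤ) (x : SqSumm) : restr s (restr s x) = restr s x :=
  restr_eq_self fun _ hj => restr_apply_of_notMem x hj

theorem exists_norm_le_sectionOp {g : ℤ → ℂ}
    (h : ∃ (n₀ : ℕ) (K : ℝ), 0 ≤ K ∧ ∀ n : ℕ, n₀ ≤ n → ∀ m p f r R : SqSumm,
      (∀ j < -(n : ℤ), m j = 0) → (∀ j, 0 ≤ j → m j = 0) → (∀ j < 0, p j = 0) →
      (∀ j, -(n : ℤ) ≤ j → r j = 0) → (∀ j < 0, R j = 0) →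
      p + conv g m = f + r + R → ‖m‖ ≤ K * ‖f‖) :
    ∃ (N₀ : ℕ) (K : ℝ), 0 ≤ K ∧ ∀ N : ℕ, N₀ < N → ∀ w : SqSumm, restr (modes N) w = w →
      ‖w‖ ≤ K * ‖sectionOp g N w‖ := by
  obtain ⟨n₀, K, hK, h⟩ := h
  refine ⟨2 * n₀, K + (1 + ‖conv g‖ * K), by positivity, fun N hN w hw => ?_⟩
  set m : SqSumm := restr (Set.Iio 0) w with hm
  set p : SqSumm := restr (Set.Ici 0) w with hp
  set y : SqSumm := conv g m with hy
  set f : SqSumm := sectionOp g N w with hf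
  have hn : Nmin N = ((N / 2 : ℕ) : ℤ) := by simp [Nmin]
  have hNpl : -1 ≤ Npl N := by rw [Npl]; omega
  have hmode : ∀ j, j ∈ modes N ↔ -((N / 2 : ℕ) : ℤ) ≤ j ∧ j ≤ Npl N := fun j => by
    rw [← hn]
    rfl
  have hmm : restr (modes N) m = m := by rw [hm, restr_comm, hw]
  have hfeq : f = p + restr (modes N) y := by
    have : f = p + restr (modes N) (conv g (restr (modes N) m)) := rfl
    rw [this, hmm]
  have hmK : ‖m‖ ≤ K * ‖f‖ := by
    refine h (N / 2) (by omega) m p f (restr (Set.Iio (-((N / 2 : ℕ) : ℤ))) y)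
      (restr (Set.Ioi (Npl N)) y) (fun j hj => ?_) (fun j hj => ?_) (fun j hj => ?_)
      (fun j hj => ?_) (fun j hj => ?_) ?_
    · rw [← hmm, restr_apply_of_notMem]
      rw [hmode]
      omega
    · exact restr_apply_of_notMem _ (by simpa using hj)
    · exact restr_apply_of_notMem _ (by simpa using hj)
    · exact restr_apply_of_notMem _ (by simpa using hj)
    · exact restr_apply_of_notMem _ (by simp only [Set.mem_Ioi]; omega)
    · rw [hfeq, add_assoc, add_assoc]
      congr 1
      apply lp.ext
      funext j
      change y j = restr _ y j + (restr _ y j + restr _ y j)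
      simp only [restr_apply, hmode, Set.mem_Iio, Set.mem_Ioi]
      rcases lt_or_ge j (-((N / 2 : ℕ) : ℤ)) with h1 | h1
      · rw [if_neg (by omega), if_pos h1, if_neg (by omega), zero_add, add_zero]
      · rcases lt_or_ge (Npl N) j with h2 | h2
        · rw [if_neg (by omega), if_neg (by omega), if_pos h2, zero_add, zero_add]
        · rw [if_pos ⟨h1, h2⟩, if_neg (by omega), if_neg (by omega), add_zero, add_zero]
  have hpf : ‖p‖ ≤ ‖f‖ + ‖conv g‖ * (K * ‖f‖) := by
    have : p = f - restr (modes N) y := by rw [hfeq, add_sub_cancel_right]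
    rw [this]
    exact (norm_sub_le _ _).trans (add_le_add le_rfl
      ((norm_restr_apply_le _ _).trans ((conv g).le_opNorm_of_le hmK)))
  have hwmp : w = m + p := by
    have := restr_add_restr_compl (Set.Iio 0) w
    rw [Set.compl_Iio] at this
    exact this.symm
  calc ‖w‖ ≤ ‖m‖ + ‖p‖ := by
        rw [hwmp]
        exact norm_add_le _ _
    _ ≤ K * ‖f‖ + (‖f‖ + ‖conv g‖ * (K * ‖f‖)) := add_le_add hmK hpf
    _ = _ := by ring

theorem modes_finite (N : ℕ) : (modes N).Finite := Set.finite_Icc _ _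

theorem memℓp_of_inPN {N : ℕ} {f : ℤ → ℂ} (hf : inPN N f) : Memℓp f 2 := by
  refine memℓp_two_iff.2 (summable_of_hasFiniteSupport ((modes_finite N).subset fun j hj => ?_))
  by_contra hcon
  refine hj ?_
  have : f j = 0 := by
    rw [← congrFun hf j, projP]
    exact if_neg hcon
  simp [this]

theorem restr_modes_eq_self_iff {N : ℕ} {w : SqSumm} : restr (modes N) w = w ↔ inPN N w := by
  rw [inPN, ← coe_restr_modes]
  exact ⟨fun h => by rw [h], fun h => lp.ext h⟩

theorem restr_modes_sectionOp {g : ℤ → ℂ} {N : ℕ} {w : SqSumm} (hw : restr (modes N) w = w) :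
    restr (modes N) (sectionOp g N w) = sectionOp g N w := by
  change restr (modes N) (restr _ w + restr (modes N) _) = restr _ w + restr (modes N) _
  rw [map_add, restr_restr, restr_comm, hw]

theorem sectionOp_surjective {g : ℤ → ℂ} {N : ℕ} {K : ℝ}
    (h : ∀ w : SqSumm, restr (modes N) w = w → ‖w‖ ≤ K * ‖sectionOp g N w‖) {f : SqSumm}
    (hf : restr (modes N) f = f) : ∃ w, restr (modes N) w = w ∧ sectionOp g N w = f := by
  let V : Submodule ℂ SqSumm := LinearMap.eqLocus (restr (modes N)).toLinearMap LinearMap.id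
  have hV : ∀ x, x ∈ V ↔ restr (modes N) x = x := fun x => Iff.rfl
  have : Finite (modes N) := modes_finite N
  let coord : V →ₗ[ℂ] (modes N → ℂ) :=
    { toFun := fun x j => (x : SqSumm) j
      map_add' := fun _ _ => rfl
      map_smul' := fun _ _ => rfl }
  have hcoord : Function.Injective coord := by
    intro x y hxy
    apply Subtype.ext
    rw [← (hV x).1 x.2, ← (hV y).1 y.2]
    apply lp.ext
    funext j
    rw [restr_apply, restr_apply]
    split_ifs with hj
    · exact congrFun hxy ⟨j, hj⟩
    · rfl
  have : FiniteDimensional ℂ V := Module.Finite.of_injective coord hcoord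
  let T : V →ₗ[ℂ] V := (sectionOp g N).toLinearMap.restrict
    (p := V) (q := V) fun x hx => restr_modes_sectionOp hx
  have hT : Function.Injective T := by
    rw [injective_iff_map_eq_zero]
    intro x hx
    have h0 : sectionOp g N x = 0 := congrArg Subtype.val hx
    have h1 := h x x.2
    rw [h0, norm_zero, mul_zero] at h1
    exact Subtype.ext (norm_le_zero_iff.1 h1)
  obtain ⟨w, hw⟩ := LinearMap.injective_iff_surjective.1 hT ⟨f, hf⟩
  exact ⟨w, w.2, congrArg Subtype.val hw⟩

theorem one_le_wt (j : ℤ) : 1 ≤ wt j := le_max_left _ _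

theorem wt_pos (j : ℤ) : 0 < wt j := one_pos.trans_le (one_le_wt j)

theorem abs_le_wt (j : ℤ) : |(j : ℝ)| ≤ wt j := le_max_right _ _

theorem hsumm.mono {a b : ℝ} (hab : a ≤ b) {u : ℤ → ℂ} (hu : hsumm b u) : hsumm a u := by
  refine Summable.of_nonneg_of_le (fun j => ?_) (fun j => ?_) hu
  · have := wt_pos j
    positivity
  · gcongr
    exact one_le_wt j

theorem hsumm.of_norm_le {t : ℝ} {u v : ℤ → ℂ} (hu : hsumm t u)
    (h : ∀ j, j ≠ 0 → ‖v j‖ ≤ ‖u j‖) : hsumm t v := by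
  refine Summable.of_norm_bounded_eventually hu ?_
  filter_upwards [(Set.finite_singleton (0 : ℤ)).compl_mem_cofinite] with j hj
  have := wt_pos j
  rw [Real.norm_of_nonneg (by positivity)]
  gcongr
  exact h j hj

theorem hsumm_one_iff {u : ℤ → ℂ} : hsumm 1 u ↔ Summable fun j => ‖u j‖ ^ 2 * wt j ^ 2 := by
  unfold hsumm
  simp only [mul_one, Real.rpow_two]

theorem summable_inv_wt_sq : Summable fun j => (wt j ^ 2)⁻¹ := by
  have h : Summable fun j : ℤ => 1 / (j : ℝ) ^ 2 := Real.summable_one_div_int_pow.2 one_lt_two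
  refine (summable_congr_cofinite ?_).1 h
  filter_upwards [(Set.finite_singleton (0 : ℤ)).compl_mem_cofinite] with j hj
  have hj' : (1 : ℝ) ≤ |(j : ℝ)| := by exact_mod_cast Int.one_le_abs hj
  rw [wt, max_eq_right hj', sq_abs, one_div]

theorem hsumm.summable_norm {u : ℤ → ℂ} (hu : hsumm 1 u) : Summable fun j => ‖u j‖ := by
  refine Summable.of_nonneg_of_le (fun j => norm_nonneg _) (fun j => ?_)
    ((hsumm_one_iff.1 hu).add summable_inv_wt_sq)
  have hw := wt_pos j
  have h : ‖u j‖ * wt j * (wt j)⁻¹ = ‖u j‖ := mul_inv_cancel_right₀ hw.ne' _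
  rw [← inv_pow, ← mul_pow]
  nlinarith [sq_nonneg (‖u j‖ * wt j - (wt j)⁻¹), norm_nonneg (u j)]

theorem hsumm.summable_sq_mul {u : ℤ → ℂ} (hu : hsumm 1 u) :
    Summable fun j : ℤ => (j : ℝ) ^ 2 * ‖u j‖ ^ 2 := by
  refine Summable.of_nonneg_of_le (fun j => by positivity) (fun j => ?_) (hsumm_one_iff.1 hu)
  rw [mul_comm, ← sq_abs (j : ℝ)]
  gcongr
  exact abs_le_wt j

theorem wt_rpow_le {s t X : ℝ} (hst : s ≤ t) (hX : 0 < X) {j : ℤ} (hj : X ≤ wt j) :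
    wt j ^ (2 * s) ≤ X ^ (2 * (s - t)) * wt j ^ (2 * t) := by
  rw [show 2 * s = 2 * (s - t) + 2 * t by ring, Real.rpow_add (wt_pos j)]
  exact mul_le_mul_of_nonneg_right (Real.rpow_le_rpow_of_nonpos hX hj (by linarith))
    (Real.rpow_nonneg (wt_pos j).le _)

theorem le_wt_of_notMem_modes {N : ℕ} {j : ℤ} (hj : j ∉ modes N) : (N : ℝ) / 2 ≤ wt j := by
  have h : ¬(-((N : ℤ) / 2) ≤ j ∧ j ≤ ((N : ℤ) - 1) / 2) := hj
  have h' : (N : ℤ) ≤ 2 * |j| := by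
    rcases abs_cases j with ⟨h1, h2⟩ | ⟨h1, h2⟩ <;> omega
  have h'' : (N : ℝ) ≤ 2 * |(j : ℝ)| := by exact_mod_cast h'
  linarith [abs_le_wt j]

theorem wt_le_of_mem_modes {N : ℕ} (hN : 0 < N) {j : ℤ} (hj : j ∈ modes N) : wt j ≤ N := by
  have h : -((N : ℤ) / 2) ≤ j ∧ j ≤ ((N : ℤ) - 1) / 2 := hj
  have h' : |j| ≤ (N : ℤ) := by
    rcases abs_cases j with ⟨h1, h2⟩ | ⟨h1, h2⟩ <;> omega
  refine max_le ?_ ?_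
  · exact_mod_cast hN
  · exact_mod_cast h'

theorem norm_restr_compl_modes_sq_le {t : ℝ} (ht : 0 ≤ t) {x : SqSumm} (hx : hsumm t x) {N : ℕ}
    (hN : 0 < N) : ‖restr (modes N)ᶜ x‖ ^ 2 ≤
      ((N : ℝ) / 2) ^ (-(2 * t)) * ∑' j, ‖x j‖ ^ 2 * wt j ^ (2 * t) := by
  rw [SqSumm.norm_sq, ← tsum_mul_left]
  refine Summable.tsum_le_tsum (fun j => ?_) (memℓp_two_iff.1 (lp.memℓp _))
    (Summable.mul_left _ hx)
  have hX : (0 : ℝ) < N / 2 := by positivity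
  have hw := wt_pos j
  by_cases hj : j ∈ modes N
  · rw [restr_apply_of_notMem _ (Set.notMem_compl_iff.2 hj)]
    simp only [norm_zero, ne_eq, OfNat.ofNat_ne_zero, not_false_eq_true, zero_pow]
    positivity
  · rw [restr_apply_of_mem _ hj]
    have h := wt_rpow_le ht hX (le_wt_of_notMem_modes hj)
    rw [mul_zero, Real.rpow_zero, zero_sub, mul_neg] at h
    nlinarith [sq_nonneg ‖x j‖]

/-- The truncation error of `x` and the finite-section error together control an `H^s` error. -/
theorem hnorm_sub_le {s t : ℝ} (hs : 0 ≤ s) (hst : s ≤ t) {x y : SqSumm} (hx : hsumm t x) {N : ℕ}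
    (hN : 0 < N) (hy : restr (modes N) y = y) {L : ℝ}
    (hL : ‖restr (modes N) x - y‖ ≤ L * ‖restr (modes N)ᶜ x‖) :
    hnorm s (x - y) ≤ √(((2 : ℝ) ^ (2 * (t - s)) + L ^ 2 * 2 ^ (2 * t)) *
      ∑' j, ‖x j‖ ^ 2 * wt j ^ (2 * t)) * (N : ℝ) ^ (s - t) := by
  set H : ℝ := ∑' j, ‖x j‖ ^ 2 * wt j ^ (2 * t) with hH
  set e : SqSumm := restr (modes N) x - y with he
  have hN' : (0 : ℝ) < N := by positivity
  have hX : (0 : ℝ) < N / 2 := by positivity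
  have hterm : ∀ j, ‖(⇑x - ⇑y) j‖ ^ 2 * wt j ^ (2 * s) ≤
      ((N : ℝ) / 2) ^ (2 * (s - t)) * (‖x j‖ ^ 2 * wt j ^ (2 * t)) +
        (N : ℝ) ^ (2 * s) * ‖e j‖ ^ 2 := by
    intro j
    have hw := wt_pos j
    by_cases hj : j ∈ modes N
    · have h1 : e j = (⇑x - ⇑y) j := by
        rw [he, lp.coeFn_sub, Pi.sub_apply, restr_apply_of_mem _ hj, Pi.sub_apply]
      have h2 : wt j ^ (2 * s) ≤ (N : ℝ) ^ (2 * s) :=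
        Real.rpow_le_rpow hw.le (wt_le_of_mem_modes hN hj) (by linarith)
      rw [h1, mul_comm ((N : ℝ) ^ (2 * s))]
      refine le_add_of_nonneg_of_le (by positivity) ?_
      gcongr
    · have h1 : (⇑x - ⇑y) j = x j := by
        rw [Pi.sub_apply, ← hy, restr_apply_of_notMem _ hj, sub_zero]
      rw [h1]
      refine le_add_of_le_of_nonneg ?_ (by positivity)
      rw [mul_left_comm]
      gcongr
      exact wt_rpow_le hst hX (le_wt_of_notMem_modes hj)
  have hes : Summable fun j => ‖e j‖ ^ 2 := memℓp_two_iff.1 (lp.memℓp e)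
  have hsum := (Summable.mul_left (((N : ℝ) / 2) ^ (2 * (s - t))) hx).add
    (hes.mul_left ((N : ℝ) ^ (2 * s)))
  have htot : ∑' j, ‖(⇑x - ⇑y) j‖ ^ 2 * wt j ^ (2 * s) ≤
      ((N : ℝ) / 2) ^ (2 * (s - t)) * H + (N : ℝ) ^ (2 * s) * ‖e‖ ^ 2 := by
    refine (Summable.tsum_le_tsum hterm (Summable.of_nonneg_of_le (fun j => ?_) hterm hsum)
      hsum).trans_eq ?_
    · have hw := wt_pos j
      positivity
    · rw [(Summable.mul_left _ hx).tsum_add (hes.mul_left _), tsum_mul_left, tsum_mul_left,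
        SqSumm.norm_sq]
  have hesq : ‖e‖ ^ 2 ≤ L ^ 2 * (((N : ℝ) / 2) ^ (-(2 * t)) * H) := by
    calc ‖e‖ ^ 2 ≤ (L * ‖restr (modes N)ᶜ x‖) ^ 2 := by gcongr
      _ = L ^ 2 * ‖restr (modes N)ᶜ x‖ ^ 2 := mul_pow _ _ _
      _ ≤ _ := by
        gcongr
        exact norm_restr_compl_modes_sq_le (hs.trans hst) hx hN
  have hpow : ∀ a : ℝ, ((N : ℝ) / 2) ^ a = (N : ℝ) ^ a * 2 ^ (-a) := fun a => by
    rw [Real.div_rpow hN'.le zero_le_two, Real.rpow_neg zero_le_two, div_eq_mul_inv]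
  have hsq : ((N : ℝ) ^ (s - t)) ^ 2 = (N : ℝ) ^ (2 * (s - t)) := by
    rw [← Real.rpow_natCast, ← Real.rpow_mul hN'.le, mul_comm]
    norm_num
  rw [hnorm, ← Real.sqrt_sq (by positivity : 0 ≤ (N : ℝ) ^ (s - t)),
    ← Real.sqrt_mul' _ (sq_nonneg _)]
  refine Real.sqrt_le_sqrt (htot.trans ?_)
  calc ((N : ℝ) / 2) ^ (2 * (s - t)) * H + (N : ℝ) ^ (2 * s) * ‖e‖ ^ 2
      ≤ ((N : ℝ) / 2) ^ (2 * (s - t)) * H +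
          (N : ℝ) ^ (2 * s) * (L ^ 2 * (((N : ℝ) / 2) ^ (-(2 * t)) * H)) := by gcongr
    _ = _ := by
      rw [hsq, hpow, hpow, show -(2 * (s - t)) = 2 * (t - s) by ring, neg_neg,
        show 2 * (s - t) = 2 * s + -(2 * t) by ring, Real.rpow_add hN']
      ring

theorem riemannHilbert_iff {g : ℤ → ℂ} (hg : Summable fun k => ‖g k‖) {x : SqSumm} :
    Cpl x - cmul g (Cmn x) = g - one1 ↔
      restr (Set.Ici 0) x + conv g (restr (Set.Iio 0) x) = conv g unitSeq - unitSeq := by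
  have h1 : Cpl x - cmul g (Cmn x) =
      ⇑(restr (Set.Ici 0) x + conv g (restr (Set.Iio 0) x)) := by
    rw [← coe_neg_restr_Iio, ← coe_restr_Ici, ← conv_apply hg, ← lp.coeFn_sub, map_neg,
      sub_neg_eq_add]
  have h2 : g - one1 = ⇑(conv g unitSeq - unitSeq) := by
    rw [lp.coeFn_sub, conv_apply hg, cmul_unitSeq]
    congr 1
    exact funext fun j => (unitSeq_apply j).symm
  rw [h1, h2]
  exact ⟨fun h => lp.ext h, fun h => by rw [h]⟩

/-- Uniqueness for the Riemann–Hilbert problem yields stability of its finite sections. -/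
theorem exists_norm_le_sectionOp_of_unique {g : ℤ → ℂ} (hg : Summable fun k => ‖g k‖)
    (hnv : nonvanishing g) {x : SqSumm} (hx : hsumm 1 x)
    (heq : restr (Set.Ici 0) x + conv g (restr (Set.Iio 0) x) = conv g unitSeq - unitSeq)
    (huniq : ∀ y : SqSumm, restr (Set.Ici 0) y + conv g (restr (Set.Iio 0) y) =
      conv g unitSeq - unitSeq → y = x) :
    ∃ (N₀ : ℕ) (K : ℝ), 0 ≤ K ∧ ∀ N : ℕ, N₀ < N → ∀ w : SqSumm, restr (modes N) w = w →
      ‖w‖ ≤ K * ‖sectionOp g N w‖ := by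
  have hunit : ∀ j, j ≠ 0 → unitSeq j = 0 := fun j hj => by
    rw [unitSeq_apply]
    exact if_neg hj
  set P : SqSumm := unitSeq + restr (Set.Ici 0) x with hP
  set M : SqSumm := unitSeq - restr (Set.Iio 0) x with hM
  have hPj : ∀ j, P j = unitSeq j + restr (Set.Ici 0) x j := fun j => rfl
  have hMj : ∀ j, M j = unitSeq j - restr (Set.Iio 0) x j := fun j => rfl
  have hPs : hsumm 1 P := hx.of_norm_le fun j hj => by
    rw [hPj, hunit j hj, zero_add, restr_apply]
    split_ifs <;> simp
  have hMs : hsumm 1 M := hx.of_norm_le fun j hj => by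
    rw [hMj, hunit j hj, zero_sub, norm_neg, restr_apply]
    split_ifs <;> simp
  refine exists_norm_le_sectionOp (exists_stability_bound hg hnv (P := P) (M := M)
    (fun j hj => ?_) (fun j hj => ?_) ?_ ?_ hPs.summable_norm hPs.summable_sq_mul
    hMs.summable_norm hMs.summable_sq_mul fun a b ha hb hab => ?_)
  · rw [hPj, hunit j hj.ne, restr_apply_of_notMem _ (by simpa using hj), add_zero]
  · rw [hMj, hunit j hj.ne', restr_apply_of_notMem _ (by simpa using hj.le), sub_zero]
  · rw [hM, hP, map_sub, eq_sub_of_add_eq' heq]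
    abel
  · intro h
    have h0 : M 0 = 0 := by
      rw [h]
      rfl
    rw [hMj, restr_apply_of_notMem _ (by simp), unitSeq_apply] at h0
    simp [one1] at h0
  · have h1 : restr (Set.Ici 0) a = a := restr_eq_self fun j hj => ha j (by simpa using hj)
    have h2 : restr (Set.Ici 0) b = 0 := restr_eq_zero fun j hj => hb j hj
    have h3 : restr (Set.Iio 0) a = 0 := restr_eq_zero fun j hj => ha j hj
    have h4 : restr (Set.Iio 0) b = b := restr_eq_self fun j hj => hb j (by simpa using hj)
    have h5 : x + (a - b) = x := huniq _ <| by
      simp only [map_add, map_sub, map_zero, h1, h2, h3, h4, ← heq]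
      rw [← hab]
      abel
    have h6 : a = b := sub_eq_zero.1 (add_eq_left.1 h5)
    rw [← h4, ← h6, h3]

theorem norm_restr_modes_sub_le {g : ℤ → ℂ} {N : ℕ} {K : ℝ} (hK : 0 ≤ K)
    (h : ∀ w : SqSumm, restr (modes N) w = w → ‖w‖ ≤ K * ‖sectionOp g N w‖) {x y : SqSumm}
    (hy : restr (modes N) y = y)
    (hxy : sectionOp g N y =
      restr (modes N) (restr (Set.Ici 0) x + conv g (restr (Set.Iio 0) x))) :
    ‖restr (modes N) x - y‖ ≤ K * ‖conv g‖ * ‖restr (modes N)ᶜ x‖ := by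
  have hsec : sectionOp g N (restr (modes N) x - y) =
      -restr (modes N) (conv g (restr (Set.Iio 0) (restr (modes N)ᶜ x))) := by
    have h1 : restr (modes N)ᶜ x = x - restr (modes N) x :=
      eq_sub_of_add_eq' (restr_add_restr_compl (modes N) x)
    have h2 : sectionOp g N (restr (modes N) x) = restr (Set.Ici 0) (restr (modes N) x) +
      restr (modes N) (conv g (restr (modes N) (restr (Set.Iio 0) (restr (modes N) x)))) := rfl
    rw [map_sub, hxy, h2, restr_comm (Set.Iio 0) (modes N), restr_restr, h1,
      restr_comm (Set.Ici 0)]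
    simp only [map_sub, map_add, restr_comm (Set.Iio 0) (modes N)]
    abel
  refine (h _ (by rw [map_sub, restr_restr, hy])).trans ?_
  rw [mul_assoc, hsec, norm_neg]
  gcongr
  exact (norm_restr_apply_le _ _).trans ((conv g).le_opNorm_of_le (norm_restr_apply_le _ _))

/-- **Statement 18.** Convergence of the finite-section method for the Riemann–Hilbert
problem on the circle: for `N` large, `𝒞⁺ - 𝓜_N(g)𝒞⁻` is invertible on `ran 𝒫_N` and the
solution `u_N` of `(𝒞⁺ - 𝓜_N(g)𝒞⁻)u_N = 𝒫_N(g - 1)` satisfies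
`‖u - u_N‖_s ≤ C_{s,t} N^{s-t}`. -/
theorem RHP_finite_section_convergence
    (t : ℝ) (ht : 1 ≤ t)
    (g : ℤ → ℂ) (hg : hsumm t g) (hnv : nonvanishing g)
    (u : ℤ → ℂ) (hu0 : hsumm 0 u) (hut : hsumm t u)
    (hueq : Cpl u - cmul g (Cmn u) = g - one1)
    (huniq : ∀ u' : ℤ → ℂ, hsumm 0 u' → Cpl u' - cmul g (Cmn u') = g - one1 → u' = u)
    (s : ℝ) (hs : s = 0 ∨ 1 / 2 < s) (hst : 2 * s < t) :
    ∃ (N₀ : ℕ) (C : ℝ), 0 < C ∧ ∀ N : ℕ, N₀ < N →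
      (∀ f : ℤ → ℂ, inPN N f →
        ∃! w : ℤ → ℂ, inPN N w ∧
          Cpl w - projP N (cmul g (projP N (Cmn w))) = f) ∧
      ∀ uN : ℤ → ℂ, inPN N uN →
        Cpl uN - projP N (cmul g (projP N (Cmn uN))) = projP N (g - one1) →
        hnorm s (u - uN) ≤ C * (N : ℝ) ^ (s - t) := by
  have hg1 : Summable fun k => ‖g k‖ := (hg.mono ht).summable_norm
  let x : SqSumm := ⟨u, hsumm_zero_iff.1 hu0⟩
  have heq := (riemannHilbert_iff hg1 (x := x)).1 hueq
  obtain ⟨N₀, K, hK, hbound⟩ := exists_norm_le_sectionOp_of_unique hg1 hnv (x := x) (hut.mono ht)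
    heq fun y hy => lp.ext <|
      huniq y (hsumm_zero_iff.2 (lp.memℓp y)) ((riemannHilbert_iff hg1).2 hy)
  have hs0 : 0 ≤ s := by rcases hs with rfl | hs <;> linarith
  refine ⟨N₀, _, add_pos_of_nonneg_of_pos (Real.sqrt_nonneg
    (((2 : ℝ) ^ (2 * (t - s)) + (K * ‖conv g‖) ^ 2 * 2 ^ (2 * t)) *
      ∑' j, ‖x j‖ ^ 2 * wt j ^ (2 * t))) one_pos, fun N hN => ⟨fun f hf => ?_, fun v hv hveq => ?_⟩⟩
  · obtain ⟨w, hw, hwf⟩ := sectionOp_surjective (hbound N hN)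
      (f := ⟨f, memℓp_of_inPN hf⟩) (restr_modes_eq_self_iff.2 hf)
    refine ⟨w, ⟨restr_modes_eq_self_iff.1 hw, by rw [← coe_sectionOp hg1, hwf]⟩, ?_⟩
    rintro v ⟨hv, hvf⟩
    let y : SqSumm := ⟨v, memℓp_of_inPN hv⟩
    have hy : restr (modes N) y = y := restr_modes_eq_self_iff.2 hv
    have hyf : sectionOp g N y = sectionOp g N w :=
      lp.ext (by rw [coe_sectionOp hg1, hwf]; exact hvf)
    have h := hbound N hN (y - w) (by rw [map_sub, hy, hw])
    rw [map_sub, hyf, sub_self, norm_zero, mul_zero] at h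
    exact congrArg (fun z : SqSumm => ⇑z) (sub_eq_zero.1 (norm_le_zero_iff.1 h))
  · let y : SqSumm := ⟨v, memℓp_of_inPN hv⟩
    have hy : restr (modes N) y = y := restr_modes_eq_self_iff.2 hv
    have hysec : sectionOp g N y =
        restr (modes N) (restr (Set.Ici 0) x + conv g (restr (Set.Iio 0) x)) := by
      apply lp.ext
      rw [coe_sectionOp hg1, coe_restr_modes, heq, lp.coeFn_sub, conv_apply hg1, cmul_unitSeq,
        show ⇑unitSeq = one1 from funext unitSeq_apply]
      exact hveq
    refine (hnorm_sub_le hs0 (by linarith) (x := x) (y := y) hut (by omega) hy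
      (norm_restr_modes_sub_le hK (hbound N hN) hy hysec)).trans ?_
    gcongr
    exact le_add_of_nonneg_right zero_le_one

end
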